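/- arXiv:2604.01143 — 2 statements merged into one kernel-verified Lean document; each statement's English description precedes it below -/
import Mathlib

section
/- For every k ≥ 0 and every n with 2n ≥ k + 7, letting av_m^k denote the number of permutations of length m with exactly k inversions avoiding both 1324 and 1342, the difference av_{n+1}^k − av_n^k is nonnegative and equals 2·op(k−n+1) + 2·op(k−n), where op(j) is the number of overpartitions of j and op(j) = 0 for j < 0. -/
/-- A permutation `π` of length `n` (as a bijection of `Fin n`, position `i` has value `π i`)
contains the pattern `p` of length `m` if some subsequence of `π` is order-isomorphic to `p`. -/
def Contains {n m : ℕ} (π : Equiv.Perm (Fin n)) (p : Equiv.Perm (Fin m)) : Prop :=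
  ∃ f : Fin m → Fin n, StrictMono f ∧ ∀ a b : Fin m, π (f a) < π (f b) ↔ p a < p b

/-- `π` avoids the pattern `p`. -/
def Avoids {n m : ℕ} (π : Equiv.Perm (Fin n)) (p : Equiv.Perm (Fin m)) : Prop :=
  ¬ Contains π p

/-- The number of inversions of `π`: pairs of positions `i < j` with `π i > π j`. -/
noncomputable def invCount {n : ℕ} (π : Equiv.Perm (Fin n)) : ℕ :=
  Nat.card {ij : Fin n × Fin n // ij.1 < ij.2 ∧ π ij.2 < π ij.1}

def p1324 : Equiv.Perm (Fin 4) := ⟨![0,2,1,3], ![0,2,1,3], by decide, by decide⟩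
def p1342 : Equiv.Perm (Fin 4) := ⟨![0,2,3,1], ![0,3,1,2], by decide, by decide⟩

/-- `av m k`: the number of permutations of length `m` with exactly `k` inversions
avoiding both 1324 and 1342. -/
noncomputable def av (m k : ℕ) : ℕ :=
  Nat.card {π : Equiv.Perm (Fin m) // invCount π = k ∧ Avoids π p1324 ∧ Avoids π p1342}

/-- `op j` for `j : ℕ`: the number of pairs `(λ, μ)` of integer partitions with
`|λ| + |μ| = j` such that all parts of `μ` are distinct (the number of overpartitions). -/
noncomputable def op (j : ℕ) : ℕ :=
  ∑ i ∈ Finset.range (j + 1),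
    Nat.card (Nat.Partition i) * Nat.card {μ : Nat.Partition (j - i) // μ.parts.Nodup}

/-- `opZ j` extends `op` to the integers by `0` on negative arguments. -/
noncomputable def opZ (j : ℤ) : ℕ := if j < 0 then 0 else op j.toNat

/-! ### Permutations by insertion of a first entry -/

/-- The permutation with first entry `a`, followed by a sequence order-isomorphic to `σ`. -/
def consPerm {n : ℕ} (a : Fin (n + 1)) (σ : Equiv.Perm (Fin n)) : Equiv.Perm (Fin (n + 1)) :=
  ((finSuccEquiv' 0).trans (Equiv.optionCongr σ)).trans (finSuccEquiv' a).symm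

@[simp]
lemma consPerm_zero {n : ℕ} (a : Fin (n + 1)) (σ : Equiv.Perm (Fin n)) :
    consPerm a σ 0 = a := by
  simp [consPerm]

@[simp]
lemma consPerm_succ {n : ℕ} (a : Fin (n + 1)) (σ : Equiv.Perm (Fin n)) (i : Fin n) :
    consPerm a σ i.succ = a.succAbove (σ i) := by
  have : finSuccEquiv' (0 : Fin (n + 1)) i.succ = some i := by
    rw [← Fin.succAbove_zero, finSuccEquiv'_succAbove]
  simp [consPerm, this]

lemma consPerm_bijective (n : ℕ) :
    Function.Bijective (fun x : Fin (n + 1) × Equiv.Perm (Fin n) ↦ consPerm x.1 x.2) := by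
  rw [Fintype.bijective_iff_injective_and_card]
  constructor
  · rintro ⟨a, σ⟩ ⟨b, τ⟩ h
    have h' : ∀ i, consPerm a σ i = consPerm b τ i := fun i ↦ by
      simpa using congrArg (fun π : Equiv.Perm (Fin (n + 1)) ↦ π i) h
    have hab : a = b := by simpa using h' 0
    subst hab
    have : σ = τ := by
      ext i
      have := h' i.succ
      simp only [consPerm_succ, Fin.succAbove_right_inj] at this
      rw [this]
    rw [this]
  · simp [Fintype.card_perm, Nat.factorial_succ]

lemma invCount_eq_sum {n : ℕ} (π : Equiv.Perm (Fin n)) :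
    invCount π = ∑ i, ∑ j, if i < j ∧ π j < π i then 1 else 0 := by
  classical
  rw [invCount, Nat.card_eq_fintype_card, Fintype.card_subtype, Finset.card_filter,
    Fintype.sum_prod_type]

lemma invCount_consPerm {n : ℕ} (a : Fin (n + 1)) (σ : Equiv.Perm (Fin n)) :
    invCount (consPerm a σ) = a + invCount σ := by
  rw [invCount_eq_sum, invCount_eq_sum, Fin.sum_univ_succ]
  congr 1
  · rw [Fin.sum_univ_succ]
    simp only [lt_self_iff_false, and_false, if_false, zero_add, Fin.succ_pos, true_and,
      consPerm_zero, consPerm_succ, Fin.succAbove_lt_iff_castSucc_lt]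
    rw [Equiv.sum_comp σ (fun y ↦ if y.castSucc < a then 1 else 0), ← Finset.card_filter]
    have ha : (a : ℕ) ≤ n := Nat.lt_succ_iff.1 a.2
    rw [← Fin.card_filter_val_lt (n := n) (m := a)|>.trans (min_eq_right ha)]
    rfl
  · refine Finset.sum_congr rfl fun i _ ↦ ?_
    rw [Fin.sum_univ_succ]
    simp

/-- `π` avoids both 1324 and 1342. -/
def AvoidsBoth {n : ℕ} (π : Equiv.Perm (Fin n)) : Prop :=
  ∀ i j l m, i < j → j < l → l < m →
    ¬ (π i < π l ∧ π l < π j ∧ π j < π m) ∧ ¬ (π i < π m ∧ π m < π j ∧ π j < π l)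

/-- The entries of `π` that are at least `d` avoid both 213 and 231. -/
def TopAvoids {n : ℕ} (π : Equiv.Perm (Fin n)) (d : ℕ) : Prop :=
  ∀ j l m, j < l → l < m →
    ¬ (d ≤ (π l : ℕ) ∧ π l < π j ∧ π j < π m) ∧ ¬ (d ≤ (π m : ℕ) ∧ π m < π j ∧ π j < π l)

lemma avoids_iff {n : ℕ} (π : Equiv.Perm (Fin n)) :
    Avoids π p1324 ∧ Avoids π p1342 ↔ AvoidsBoth π := by
  constructor
  · rintro ⟨h₁, h₂⟩ i j l m hij hjl hlm
    have hmono : StrictMono ![i, j, l, m] := by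
      rw [Fin.strictMono_iff_lt_succ]
      intro x
      fin_cases x <;> simpa
    constructor
    · rintro ⟨a, b, c⟩
      refine h₁ ⟨![i, j, l, m], hmono, fun x y ↦ ?_⟩
      fin_cases x <;> fin_cases y <;> simp [p1324] <;> order
    · rintro ⟨a, b, c⟩
      refine h₂ ⟨![i, j, l, m], hmono, fun x y ↦ ?_⟩
      fin_cases x <;> fin_cases y <;> simp [p1342] <;> order
  · intro h
    constructor
    · rintro ⟨f, hf, hp⟩
      refine (h (f 0) (f 1) (f 2) (f 3) (hf (by decide)) (hf (by decide)) (hf (by decide))).1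
        ⟨(hp _ _).2 (by decide), (hp _ _).2 (by decide), (hp _ _).2 (by decide)⟩
    · rintro ⟨f, hf, hp⟩
      refine (h (f 0) (f 1) (f 2) (f 3) (hf (by decide)) (hf (by decide)) (hf (by decide))).2
        ⟨(hp _ _).2 (by decide), (hp _ _).2 (by decide), (hp _ _).2 (by decide)⟩

lemma avoidsBoth_consPerm {n : ℕ} (a : Fin (n + 1)) (σ : Equiv.Perm (Fin n)) :
    AvoidsBoth (consPerm a σ) ↔ AvoidsBoth σ ∧ TopAvoids σ a := by
  unfold AvoidsBoth TopAvoids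
  simp only [Fin.forall_fin_succ (n := n), consPerm_zero, consPerm_succ, Fin.succ_lt_succ_iff,
    Fin.succAbove_lt_succAbove_iff, Fin.not_lt_zero, Fin.succ_pos, false_imp_iff, true_imp_iff,
    imp_true_iff, true_and, Fin.lt_succAbove_iff_le_castSucc, Fin.le_def, Fin.val_castSucc]
  tauto

lemma topAvoids_consPerm {n : ℕ} (a : Fin (n + 1)) (σ : Equiv.Perm (Fin n)) (d : ℕ)
    (hσ : TopAvoids σ a) :
    TopAvoids (consPerm a σ) d ↔ ((a : ℕ) = n ∧ TopAvoids σ d) ∨ ((a : ℕ) < n ∧ (a : ℕ) ≤ d) := by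
  have hval : ∀ y : Fin n, (a.succAbove y : ℕ) = if (y : ℕ) < a then (y : ℕ) else y + 1 := by
    intro y
    simp only [Fin.succAbove, Fin.lt_def, Fin.val_castSucc]
    split_ifs <;> simp
  have ha : (a : ℕ) ≤ n := Nat.lt_succ_iff.1 a.2
  constructor
  · intro h
    rcases ha.eq_or_lt with ha | ha
    · refine Or.inl ⟨ha, fun j l m hjl hlm ↦ ?_⟩
      have := h j.succ l.succ m.succ (by simpa) (by simpa)
      simp only [consPerm_succ, Fin.lt_def, hval] at this ⊢
      grind
    · refine Or.inr ⟨ha, ?_⟩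
      by_contra! hd
      obtain ⟨x, hx⟩ := σ.surjective ⟨d, by omega⟩
      obtain ⟨y, hy⟩ := σ.surjective ⟨a, ha⟩
      have hx' : (σ x : ℕ) = d := by rw [hx]
      have hy' : (σ y : ℕ) = a := by rw [hy]
      have hne : x ≠ y := by
        rintro rfl
        omega
      rcases lt_or_gt_of_ne hne with hxy | hxy
      · apply (h 0 x.succ y.succ (by simp) (by simpa)).1
        simp only [consPerm_succ, consPerm_zero, Fin.lt_def, hval]
        grind
      · apply (h 0 y.succ x.succ (by simp) (by simpa)).2
        simp only [consPerm_succ, consPerm_zero, Fin.lt_def, hval]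
        grind
  · intro h j l m
    have hn : ∀ y, (σ y : ℕ) < n := fun y ↦ (σ y).2
    have hσ' : ((a : ℕ) = n ∧ TopAvoids σ d) ∨ ((a : ℕ) ≤ d ∧ TopAvoids σ a) := by tauto
    refine Fin.cases ?_ (fun j ↦ ?_) j <;> refine Fin.cases ?_ (fun l ↦ ?_) l <;>
      refine Fin.cases ?_ (fun m ↦ ?_) m <;> intro hjl hlm <;>
      simp only [Fin.not_lt_zero, Fin.succ_lt_succ_iff] at hjl hlm
    · have := hn l
      have := hn m
      simp only [consPerm_succ, consPerm_zero, Fin.lt_def, hval]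
      grind
    · have h₁ := hn j
      have h₂ := hn l
      have h₃ := hn m
      simp only [consPerm_succ, Fin.lt_def, hval]
      rcases hσ' with ⟨_, H⟩ | ⟨_, H⟩ <;>
      · have := H j l m hjl hlm
        simp only [Fin.lt_def] at this
        grind

/-! ### Overpartitions -/

/-- The sum of all parts of a pair `(λ, μ)`. -/
def pairSize (x : Multiset ℕ × Finset ℕ) : ℕ := x.1.sum + ∑ p ∈ x.2, p

/-- The number of parts of `λ` that are at least `v` and of parts of `μ` that exceed `v`. -/
def countAbove (x : Multiset ℕ × Finset ℕ) (v : ℕ) : ℕ :=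
  (x.1.filter (v ≤ ·)).card + (x.2.filter (v < ·)).card

/-- The pairs `(λ, μ)` corresponding to permutations of length `n`. -/
structure Fits (n : ℕ) (x : Multiset ℕ × Finset ℕ) : Prop where
  zero_notMem_fst : 0 ∉ x.1
  zero_notMem_snd : 0 ∉ x.2
  lt_of_mem_snd : ∀ p ∈ x.2, p < n
  lt_of_mem_fst : ∀ v ∈ x.1, v + countAbove x v < n

/-- The pair obtained by adding the part `a`, to `μ` if `a = n` and to `λ` if `0 < a < n`. -/
def addPart (n a : ℕ) (x : Multiset ℕ × Finset ℕ) : Multiset ℕ × Finset ℕ :=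
  if a = n then (x.1, insert n x.2) else if a = 0 then x else (a ::ₘ x.1, x.2)

lemma Fits.lt_of_mem {n : ℕ} {x : Multiset ℕ × Finset ℕ} (h : Fits n x) {v : ℕ}
    (hv : v ∈ x.1) : v + 1 < n := by
  have h₁ := h.lt_of_mem_fst v hv
  have : 0 < (x.1.filter (v ≤ ·)).card := Multiset.card_pos_iff_exists_mem.2
    ⟨v, Multiset.mem_filter.2 ⟨hv, le_rfl⟩⟩
  unfold countAbove at h₁
  omega

lemma Fits.notMem_snd {n : ℕ} {x : Multiset ℕ × Finset ℕ} (h : Fits n x) : n ∉ x.2 :=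
  fun hn ↦ (h.lt_of_mem_snd n hn).false

lemma pairSize_addPart {n a : ℕ} {x : Multiset ℕ × Finset ℕ} (h : n ∉ x.2) :
    pairSize (addPart n a x) = a + pairSize x := by
  unfold addPart pairSize
  split_ifs with h₁ h₂
  · dsimp only
    rw [Finset.sum_insert h]
    omega
  · omega
  · dsimp only
    rw [Multiset.sum_cons]
    omega

lemma fits_insert_iff {n : ℕ} (hn : 1 ≤ n) {x : Multiset ℕ × Finset ℕ} (hx : n ∉ x.2) :
    Fits (n + 1) (x.1, insert n x.2) ↔ Fits n x := by
  have key : ∀ v < n, countAbove (x.1, insert n x.2) v = countAbove x v + 1 := by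
    intro v hv
    simp only [countAbove, Finset.filter_insert, hv, if_true]
    rw [Finset.card_insert_of_notMem (by simp [hx])]
    omega
  constructor
  · intro h
    refine ⟨h.1, fun h0 ↦ h.2 (Finset.mem_insert_of_mem h0), fun p hp ↦ ?_, fun v hv ↦ ?_⟩
    · have := h.3 p (Finset.mem_insert_of_mem hp)
      have : p ≠ n := by
        rintro rfl
        exact hx hp
      omega
    · have h₁ := h.lt_of_mem hv
      have h₂ := h.4 v hv
      rw [key v (by omega)] at h₂
      omega
  · intro h
    refine ⟨h.1, ?_, ?_, fun v hv ↦ ?_⟩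
    · simp only [Finset.mem_insert, not_or]
      exact ⟨by omega, h.2⟩
    · simp only [Finset.mem_insert, forall_eq_or_imp]
      exact ⟨by omega, fun p hp ↦ (h.3 p hp).trans (by omega)⟩
    · have h₁ := h.lt_of_mem hv
      have h₂ := h.4 v hv
      rw [key v (by omega)]
      omega

lemma fits_cons_iff {n a : ℕ} (ha₀ : a ≠ 0) (ha : a < n) {x : Multiset ℕ × Finset ℕ}
    (hx : n ∉ x.2) (hle : ∀ v ∈ x.1, v ≤ a) :
    Fits (n + 1) (a ::ₘ x.1, x.2) ↔ Fits n x := by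
  have key : ∀ v ≤ a, countAbove (a ::ₘ x.1, x.2) v = countAbove x v + 1 := by
    intro v hv
    simp only [countAbove, Multiset.filter_cons_of_pos (p := (v ≤ ·)) _ hv, Multiset.card_cons]
    omega
  constructor
  · intro h
    refine ⟨fun h0 ↦ h.1 (Multiset.mem_cons_of_mem h0), h.2, fun p hp ↦ ?_, fun v hv ↦ ?_⟩
    · have := h.3 p hp
      have : p ≠ n := by
        rintro rfl
        exact hx hp
      omega
    · have h₂ := h.4 v (Multiset.mem_cons_of_mem hv)
      rw [key v (hle v hv)] at h₂
      omega
  · intro h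
    have hmem : ∀ v ∈ x.1, v + countAbove (a ::ₘ x.1, x.2) v < n + 1 := fun v hv ↦ by
      have h₂ := h.4 v hv
      rw [key v (hle v hv)]
      omega
    refine ⟨?_, h.2, fun p hp ↦ (h.3 p hp).trans (by omega), fun v hv ↦ ?_⟩
    · simp only [Multiset.mem_cons, not_or]
      exact ⟨ha₀.symm, h.1⟩
    · rcases Multiset.mem_cons.1 hv with rfl | hv
      · by_cases hv' : v ∈ x.1
        · exact hmem v hv'
        · rw [key v le_rfl]
          have h₁ : x.1.filter (v ≤ ·) = 0 := by
            rw [Multiset.filter_eq_nil]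
            intro w hw hvw
            exact hv' (le_antisymm hvw (hle w hw) ▸ hw)
          have h₂ : (x.2.filter (v < ·)).card ≤ (Finset.Ioo v n).card :=
            Finset.card_le_card fun p hp ↦ by
              rw [Finset.mem_filter] at hp
              exact Finset.mem_Ioo.2 ⟨hp.2, h.3 p hp.1⟩
          rw [Nat.card_Ioo] at h₂
          simp only [countAbove, h₁, Multiset.card_zero]
          omega
      · exact hmem v hv

lemma fits_succ_of_fst_eq_zero {n : ℕ} {x : Multiset ℕ × Finset ℕ} (hx : n ∉ x.2)
    (h0 : x.1 = 0) : Fits (n + 1) x ↔ Fits n x := by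
  constructor
  · intro h
    refine ⟨h.1, h.2, fun p hp ↦ ?_, by simp [h0]⟩
    have := h.3 p hp
    have : p ≠ n := by
      rintro rfl
      exact hx hp
    omega
  · exact fun h ↦ ⟨h.1, h.2, fun p hp ↦ (h.3 p hp).trans (by omega), by simp [h0]⟩

/-- Adding a part that is either `n` or at least as large as all parts of `λ` turns the pairs
that fit `n` bijectively into the pairs that fit `n + 1`. -/
lemma bijOn_addPart {n : ℕ} (hn : 1 ≤ n) :
    Set.BijOn (fun y : Fin (n + 1) × (Multiset ℕ × Finset ℕ) ↦ addPart n y.1 y.2)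
      {y | Fits n y.2 ∧ ∀ v ∈ y.2.1, v ≤ y.1} {x | Fits (n + 1) x} := by
  have hzero : ∀ {x : Multiset ℕ × Finset ℕ}, Fits n x → (∀ v ∈ x.1, v ≤ 0) → x.1 = 0 := by
    intro x hx h
    refine Multiset.eq_zero_of_forall_notMem fun v hv ↦ hx.1 ?_
    rwa [← Nat.le_zero.1 (h v hv)]
  refine ⟨?_, ?_, ?_⟩
  · rintro ⟨a, x⟩ ⟨hx, hle⟩
    simp only [Set.mem_ofPred_eq, addPart]
    have ha := a.2
    split_ifs with h₁ h₂
    · exact (fits_insert_iff hn hx.notMem_snd).2 hx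
    · refine (fits_succ_of_fst_eq_zero hx.notMem_snd (hzero hx ?_)).2 hx
      rwa [h₂] at hle
    · exact (fits_cons_iff h₂ (by omega) hx.notMem_snd hle).2 hx
  · rintro ⟨a, l, s⟩ ⟨hx, hle⟩ ⟨b, l', s'⟩ ⟨hx', hle'⟩ h
    have ns := hx.notMem_snd
    have ns' := hx'.notMem_snd
    simp only [addPart] at h hle hle' ns ns'
    have hab : ∀ {a b : Fin (n + 1)}, (a : ℕ) = b → a = b := fun h ↦ Fin.ext h
    split_ifs at h with h₁ h₂ h₃ h₄ h₅ h₆ <;> simp only [Prod.mk.injEq] at h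
    · obtain ⟨rfl, h⟩ := h
      have : s = s' := by
        rw [← Finset.erase_insert ns, h, Finset.erase_insert ns']
      rw [this, hab (h₁.trans h₂.symm)]
    · exact absurd (h.2 ▸ Finset.mem_insert_self n s) ns'
    · exact absurd (h.2 ▸ Finset.mem_insert_self n s) ns'
    · exact absurd (h.2 ▸ Finset.mem_insert_self n s') ns
    · obtain ⟨rfl, rfl⟩ := h
      rw [hab (h₄.trans h₆.symm)]
    · have := hzero hx (h₄ ▸ hle)
      simp only at this
      rw [this] at h
      exact absurd h.1.symm Multiset.cons_ne_zero
    · exact absurd (h.2 ▸ Finset.mem_insert_self n s') ns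
    · have := hzero hx' (by simpa [*] using hle')
      simp only at this
      rw [this] at h
      exact absurd h.1 Multiset.cons_ne_zero
    · obtain ⟨h, rfl⟩ := h
      have h₇ : (a : ℕ) ≤ b := by
        have : (a : ℕ) ∈ (b : ℕ) ::ₘ l' := h ▸ Multiset.mem_cons_self _ _
        rcases Multiset.mem_cons.1 this with h | h
        · exact h.le
        · exact hle' _ h
      have h₈ : (b : ℕ) ≤ a := by
        have : (b : ℕ) ∈ (a : ℕ) ::ₘ l := h ▸ Multiset.mem_cons_self _ _
        rcases Multiset.mem_cons.1 this with h | h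
        · exact h.le
        · exact hle _ h
      have h₉ := hab (le_antisymm h₇ h₈)
      subst h₉
      rw [Multiset.cons_inj_right] at h
      rw [h]
  · rintro ⟨l, s⟩ h
    simp only [Set.mem_ofPred_eq] at h
    by_cases hs : n ∈ s
    · refine ⟨(Fin.last n, l, s.erase n), ⟨?_, fun v hv ↦ ?_⟩, ?_⟩
      · rw [← fits_insert_iff hn (by simp)]
        simpa [Finset.insert_erase hs] using h
      · have := h.lt_of_mem hv
        simp only [Fin.val_last]
        omega
      · simp [addPart, Finset.insert_erase hs]
    · by_cases hl : l = 0
      · refine ⟨(0, l, s), ⟨(fits_succ_of_fst_eq_zero hs hl).1 h, by simp [hl]⟩, ?_⟩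
        simp [addPart, show 0 ≠ n by omega]
      · obtain ⟨a, ha, hmax⟩ := l.toFinset.exists_max_image id
          (by simpa [Finset.nonempty_iff_ne_empty] using hl)
        simp only [Multiset.mem_toFinset, id] at ha hmax
        have han : a + 1 < n + 1 := h.lt_of_mem ha
        have ha₀ : a ≠ 0 := by
          rintro rfl
          exact h.1 ha
        have hle : ∀ v ∈ l.erase a, v ≤ a := fun v hv ↦ hmax v (Multiset.mem_of_mem_erase hv)
        refine ⟨(⟨a, by omega⟩, l.erase a, s), ⟨?_, hle⟩, ?_⟩
        · rw [← fits_cons_iff (a := a) ha₀ (by omega) hs hle]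
          simpa [Multiset.cons_erase ha] using h
        · simp [addPart, show a ≠ n by omega, ha₀, Multiset.cons_erase ha]

/-- The encoding of permutations avoiding 1324 and 1342 by pairs `(λ, μ)`. -/
lemma exists_encoding (n : ℕ) (hn : 1 ≤ n) :
    ∃ f : Equiv.Perm (Fin n) → Multiset ℕ × Finset ℕ,
      Set.BijOn f {π | AvoidsBoth π} {x | Fits n x} ∧
      ∀ π, AvoidsBoth π → invCount π = pairSize (f π) ∧
        ∀ d, TopAvoids π d ↔ ∀ v ∈ (f π).1, v ≤ d := by
  induction n, hn using Nat.le_induction with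
  | base =>
    refine ⟨fun _ ↦ (0, ∅), ⟨?_, ?_, ?_⟩, ?_⟩
    · exact fun _ _ ↦ ⟨by simp, by simp, by simp, by simp⟩
    · exact fun _ _ _ _ _ ↦ Subsingleton.elim _ _
    · rintro ⟨l, s⟩ h
      refine ⟨1, ?_, ?_⟩
      · intro i j l m hij
        exact absurd hij (by simp [Subsingleton.elim i j])
      · have h₁ : l = 0 := Multiset.eq_zero_of_forall_notMem fun v hv ↦ by
          have := h.lt_of_mem hv
          omega
        have h₂ : s = ∅ := Finset.eq_empty_of_forall_notMem fun p hp ↦ by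
          have h₃ := h.lt_of_mem_snd p hp
          have h₄ : p = 0 := by omega
          exact h.2 (h₄ ▸ hp)
        simp [h₁, h₂]
    · intro π _
      constructor
      · simp [invCount_eq_sum, pairSize]
      · intro d
        simp only [Multiset.notMem_zero, false_imp_iff, imp_true_iff, iff_true]
        intro i j l hij
        exact absurd hij (by simp [Subsingleton.elim i j])
  | succ n hn ih =>
    obtain ⟨f, hf, hf'⟩ := ih
    let e := Equiv.ofBijective _ (consPerm_bijective n)
    have he : ∀ a σ, e.symm (consPerm a σ) = (a, σ) := fun a σ ↦
      e.symm_apply_apply (a, σ)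
    have h₁ : Set.BijOn e.symm {π | AvoidsBoth π} {y | AvoidsBoth y.2 ∧ TopAvoids y.2 y.1} := by
      refine e.symm.bijOn fun π ↦ ?_
      obtain ⟨⟨a, σ⟩, rfl⟩ := e.surjective π
      rw [e.symm_apply_apply]
      exact (avoidsBoth_consPerm a σ).symm
    have h₂ : Set.BijOn (fun y : Fin (n + 1) × Equiv.Perm (Fin n) ↦ (y.1, f y.2))
        {y | AvoidsBoth y.2 ∧ TopAvoids y.2 y.1} {y | Fits n y.2 ∧ ∀ v ∈ y.2.1, v ≤ y.1} := by
      refine ⟨?_, ?_, ?_⟩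
      · rintro ⟨a, σ⟩ ⟨h, h'⟩
        exact ⟨hf.mapsTo h, ((hf' σ h).2 a).1 h'⟩
      · rintro ⟨a, σ⟩ ⟨h, -⟩ ⟨b, τ⟩ ⟨h', -⟩ hab
        simp only [Prod.mk.injEq] at hab
        exact Prod.ext hab.1 (hf.injOn h h' hab.2)
      · rintro ⟨a, x⟩ ⟨hx, hle⟩
        obtain ⟨σ, hσ, rfl⟩ := hf.surjOn hx
        exact ⟨(a, σ), ⟨hσ, ((hf' σ hσ).2 a).2 hle⟩, rfl⟩
    refine ⟨_, (bijOn_addPart hn).comp (h₂.comp h₁), fun π hπ ↦ ?_⟩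
    obtain ⟨⟨a, σ⟩, rfl⟩ := (consPerm_bijective n).2 π
    obtain ⟨hσ, hσ'⟩ := (avoidsBoth_consPerm a σ).1 hπ
    simp only [Function.comp_apply, he]
    have hx : Fits n (f σ) := hf.mapsTo hσ
    have hle := ((hf' σ hσ).2 a).1 hσ'
    refine ⟨?_, fun d ↦ ?_⟩
    · rw [invCount_consPerm, pairSize_addPart hx.notMem_snd, (hf' σ hσ).1]
    · rw [topAvoids_consPerm a σ d hσ', (hf' σ hσ).2]
      have ha := a.2
      unfold addPart
      split_ifs with h₃ h₄
      · simp [h₃]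
      · rw [h₄] at hle ⊢
        have : 0 < n := by omega
        simp only [this, zero_le, and_self, or_true, true_iff]
        exact fun v hv ↦ (hle v hv).trans zero_le
      · simp only [h₃, false_and, false_or, Multiset.mem_cons, forall_eq_or_imp,
          show (a : ℕ) < n by omega, true_and]
        exact ⟨fun h ↦ ⟨h, fun v hv ↦ (hle v hv).trans h⟩, fun h ↦ h.1⟩

lemma av_eq_ncard (n k : ℕ) (hn : 1 ≤ n) : av n k = {x | Fits n x ∧ pairSize x = k}.ncard := by
  obtain ⟨f, hf, hf'⟩ := exists_encoding n hn
  have h : {x | Fits n x ∧ pairSize x = k} =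
      f '' {π | invCount π = k ∧ Avoids π p1324 ∧ Avoids π p1342} := by
    simp only [avoids_iff]
    ext x
    constructor
    · rintro ⟨hx, hk⟩
      obtain ⟨π, hπ, rfl⟩ := hf.surjOn hx
      exact ⟨π, ⟨(hf' π hπ).1.trans hk, hπ⟩, rfl⟩
    · rintro ⟨π, ⟨hk, hπ⟩, rfl⟩
      exact ⟨hf.mapsTo hπ, (hf' π hπ).1.symm.trans hk⟩
  rw [h, Set.InjOn.ncard_image]
  · rfl
  · exact hf.injOn.mono fun π hπ ↦ (avoids_iff π).1 hπ.2

/-- The pairs `(λ, μ)` of partitions of total size `j` where `μ` has distinct parts. -/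
def overpart (j : ℤ) : Set (Multiset ℕ × Finset ℕ) :=
  {x | 0 ∉ x.1 ∧ 0 ∉ x.2 ∧ (pairSize x : ℤ) = j}

/-- The overpartitions of `j`, graded by the size of the unrestricted partition `λ`. -/
def overpartOfSigma (j : ℕ)
    (y : Σ i : Fin (j + 1), Nat.Partition i × {μ : Nat.Partition (j - i) // μ.parts.Nodup}) :
    overpart j :=
  ⟨(y.2.1.parts, ⟨y.2.2.1.parts, y.2.2.2⟩), fun h ↦ (y.2.1.parts_pos h).false,
    fun h ↦ (y.2.2.1.parts_pos h).false, by
      have h₁ : (y.1 : ℕ) ≤ j := Nat.lt_succ_iff.1 y.1.2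
      have h₂ := y.2.1.parts_sum
      have h₃ := y.2.2.1.parts_sum
      simp only [pairSize, Finset.sum_mk, Multiset.map_id']
      omega⟩

lemma overpartOfSigma_bijective (j : ℕ) : Function.Bijective (overpartOfSigma j) := by
  constructor
  · rintro ⟨i, l, m, hm⟩ ⟨i', l', m', hm'⟩ h
    have h₁ : l.parts = l'.parts := congrArg (fun x ↦ x.1.1) h
    have h₂ : m.parts = m'.parts := congrArg (fun x ↦ x.1.2.val) h
    have hi : i = i' := by
      ext
      rw [← l.parts_sum, h₁, l'.parts_sum]
    subst hi
    have h₃ := Nat.Partition.ext h₁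
    have h₄ := Nat.Partition.ext h₂
    subst h₃ h₄
    rfl
  · rintro ⟨⟨l, s⟩, hl, hs, h⟩
    simp only [pairSize, Nat.cast_inj] at h
    have hs' : s.val.sum = ∑ p ∈ s, p := by
      rw [Finset.sum, Multiset.map_id']
    refine ⟨⟨⟨l.sum, by omega⟩, ⟨l, fun {v} hv ↦ Nat.pos_of_ne_zero ?_, rfl⟩,
      ⟨⟨s.val, fun {v} hv ↦ Nat.pos_of_ne_zero ?_, ?_⟩, s.nodup⟩⟩, rfl⟩
    · rintro rfl
      exact hl hv
    · rintro rfl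
      exact hs hv
    · simp only
      omega

lemma overpart_of_neg {j : ℤ} (hj : j < 0) : overpart j = ∅ := by
  refine Set.eq_empty_of_forall_notMem fun x hx ↦ ?_
  have := hx.2.2
  omega

lemma overpart_finite (j : ℤ) : (overpart j).Finite := by
  rcases lt_or_ge j 0 with hj | hj
  · rw [overpart_of_neg hj]
    exact Set.finite_empty
  · lift j to ℕ using hj
    exact Set.finite_coe_iff.1 (Finite.of_surjective _ (overpartOfSigma_bijective j).2)

lemma ncard_overpart (j : ℤ) : (overpart j).ncard = opZ j := by
  unfold opZ
  split_ifs with hj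
  · rw [overpart_of_neg hj, Set.ncard_empty]
  · lift j to ℕ using not_lt.1 hj
    rw [← Nat.card_coe_set_eq, ← Nat.card_congr (Equiv.ofBijective _ (overpartOfSigma_bijective j)),
      Nat.card_sigma, Int.toNat_natCast, op, ← Fin.sum_univ_eq_sum_range
      (fun i ↦ Nat.card (Nat.Partition i) * Nat.card {μ : Nat.Partition (j - i) // μ.parts.Nodup})]
    simp only [Nat.card_prod]

section Bounds

variable {x : Multiset ℕ × Finset ℕ}

lemma add_le_pairSize_of_mem_of_mem {v p : ℕ} (hv : v ∈ x.1) (hp : p ∈ x.2) :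
    v + p ≤ pairSize x :=
  add_le_add (Multiset.le_sum_of_mem hv) (Finset.single_le_sum (f := fun p ↦ p)
    (fun _ _ ↦ Nat.zero_le _) hp)

lemma add_le_pairSize_of_mem_snd {p q : ℕ} (hp : p ∈ x.2) (hq : q ∈ x.2) (hpq : p ≠ q) :
    p + q ≤ pairSize x := by
  have h := Finset.sum_le_sum_of_subset (f := fun p : ℕ ↦ p) (s := {p, q}) (t := x.2)
    (by simp [Finset.insert_subset_iff, hp, hq])
  rw [Finset.sum_pair hpq] at h
  exact h.trans (Nat.le_add_left _ _)

lemma add_le_pairSize_of_mem_fst {v w : ℕ} (hv : v ∈ x.1) (hw : w ∈ x.1) (hvw : v ≠ w) :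
    v + w ≤ pairSize x := by
  have h₁ := Multiset.cons_erase hv
  have h₂ : w ∈ x.1.erase v := (Multiset.mem_erase_of_ne hvw.symm).2 hw
  have h₃ := Multiset.le_sum_of_mem h₂
  have h₄ : v + (x.1.erase v).sum = x.1.sum := by rw [← Multiset.sum_cons, h₁]
  unfold pairSize
  omega

lemma card_le_sum_of_zero_notMem {l : Multiset ℕ} (h : 0 ∉ l) : l.card ≤ l.sum := by
  have := Multiset.card_nsmul_le_sum (s := l) (a := 1)
    (fun v hv ↦ Nat.pos_of_ne_zero fun h0 ↦ h (h0 ▸ hv))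
  simpa using this

lemma card_le_finset_sum_of_zero_notMem {s : Finset ℕ} (h : 0 ∉ s) : s.card ≤ ∑ p ∈ s, p := by
  have := Finset.card_nsmul_le_sum s (fun p ↦ p) 1
    (fun v hv ↦ Nat.pos_of_ne_zero fun h0 ↦ h (h0 ▸ hv))
  simpa using this

lemma card_add_card_le_pairSize (h₁ : 0 ∉ x.1) (h₂ : 0 ∉ x.2) :
    x.1.card + x.2.card ≤ pairSize x :=
  add_le_add (card_le_sum_of_zero_notMem h₁) (card_le_finset_sum_of_zero_notMem h₂)

lemma add_card_le_pairSize (h₁ : 0 ∉ x.1) (h₂ : 0 ∉ x.2) {w : ℕ} (hw : w ∈ x.1 ∨ w ∈ x.2) :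
    w + (x.1.card + x.2.card) ≤ pairSize x + 1 := by
  have hl := card_le_sum_of_zero_notMem h₁
  have hs := card_le_finset_sum_of_zero_notMem h₂
  unfold pairSize
  rcases hw with hw | hw
  · have h₃ := card_le_sum_of_zero_notMem (l := x.1.erase w)
      fun h ↦ h₁ (Multiset.mem_of_mem_erase h)
    have h₄ := Multiset.sum_erase hw
    have h₅ := Multiset.card_erase_add_one hw
    omega
  · have h₃ := card_le_finset_sum_of_zero_notMem (s := x.2.erase w)
      fun h ↦ h₂ (Finset.mem_of_mem_erase h)
    have h₄ := Finset.sum_erase_add x.2 (fun p ↦ p) hw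
    have h₅ := Finset.card_erase_add_one hw
    omega

lemma countAbove_le (v : ℕ) : countAbove x v ≤ x.1.card + x.2.card :=
  add_le_add (Multiset.card_le_card (Multiset.filter_le _ _)) (Finset.card_filter_le _ _)

lemma countAbove_mul_le (v : ℕ) : countAbove x v * v ≤ pairSize x := by
  have h₁ := Multiset.card_nsmul_le_sum (s := x.1.filter (v ≤ ·)) (a := v)
    (fun w hw ↦ (Multiset.mem_filter.1 hw).2)
  have h₂ := Finset.card_nsmul_le_sum (x.2.filter (v < ·)) (fun p ↦ p) v
    (fun p hp ↦ (Finset.mem_filter.1 hp).2.le)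
  have h₃ : (x.1.filter (v ≤ ·)).sum ≤ x.1.sum := by
    conv_rhs => rw [← Multiset.filter_add_not (v ≤ ·) x.1, Multiset.sum_add]
    omega
  have h₄ : ∑ p ∈ x.2.filter (v < ·), p ≤ ∑ p ∈ x.2, p :=
    Finset.sum_le_sum_of_subset (Finset.filter_subset _ _)
  simp only [smul_eq_mul] at h₁ h₂
  rw [countAbove, add_mul, pairSize]
  omega

lemma countAbove_pos {v : ℕ} (hv : v ∈ x.1) : 0 < countAbove x v :=
  Nat.add_pos_left (Multiset.card_pos_iff_exists_mem.2
    ⟨v, Multiset.mem_filter.2 ⟨hv, le_rfl⟩⟩) _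

/-- A part of `λ` with a large hook is either the unique part of its size or larger, or it is 1. -/
lemma eq_one_or_countAbove_eq_one {n v : ℕ} (h₁ : 0 ∉ x.1) (hk : pairSize x + 7 ≤ 2 * n)
    (hv : v ∈ x.1) (hn : n ≤ v + countAbove x v) : v = 1 ∨ countAbove x v = 1 := by
  have h₂ := countAbove_mul_le (x := x) v
  have h₃ := countAbove_pos hv
  have h₄ : v ≠ 0 := by
    rintro rfl
    exact h₁ hv
  by_contra! h
  obtain ⟨a, rfl⟩ : ∃ a, v = a + 2 := ⟨v - 2, by omega⟩
  obtain ⟨b, hb⟩ : ∃ b, countAbove x (a + 2) = b + 2 := ⟨countAbove x (a + 2) - 2, by omega⟩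
  rw [hb] at h₂ hn
  nlinarith [Nat.zero_le (a * b)]

/-- Classification of the pairs that fit `n + 1` but not `n`. -/
lemma fits_succ_and_not_fits_iff {n : ℕ} (h₁ : 0 ∉ x.1) (h₂ : 0 ∉ x.2)
    (hk : pairSize x + 7 ≤ 2 * n) :
    (Fits (n + 1) x ∧ ¬ Fits n x) ↔
      n ∈ x.2 ∨ n - 1 ∈ x.1 ∨ (1 ∈ x.1 ∧ countAbove x 1 = n - 1) := by
  constructor
  · rintro ⟨h, hn⟩
    by_contra! H
    refine hn ⟨h₁, h₂, fun p hp ↦ ?_, fun v hv ↦ ?_⟩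
    · have := h.3 p hp
      have : p ≠ n := by
        rintro rfl
        exact H.1 hp
      omega
    · by_contra! hlt
      have h₃ := h.4 v hv
      rcases eq_one_or_countAbove_eq_one h₁ hk hv hlt with rfl | h₄
      · exact H.2.2 hv (by omega)
      · have : v = n - 1 := by omega
        exact H.2.1 (this ▸ hv)
  · intro H
    refine ⟨⟨h₁, h₂, fun p hp ↦ ?_, fun v hv ↦ ?_⟩, fun h ↦ ?_⟩
    · by_contra! hlt
      rcases H with H | H | ⟨-, H⟩
      · have := add_le_pairSize_of_mem_snd hp H (by omega)
        omega
      · have := add_le_pairSize_of_mem_of_mem H hp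
        omega
      · have := add_card_le_pairSize h₁ h₂ (Or.inr hp)
        have := countAbove_le (x := x) 1
        omega
    · by_contra! hlt
      have h₃ := countAbove_le (x := x) v
      rcases eq_one_or_countAbove_eq_one h₁ hk hv (by omega) with rfl | h₄
      · rcases H with H | H | ⟨-, H⟩
        · have := add_card_le_pairSize h₁ h₂ (Or.inr H)
          omega
        · have := add_card_le_pairSize h₁ h₂ (Or.inl H)
          omega
        · omega
      · rcases H with H | H | ⟨-, H⟩
        · have := add_le_pairSize_of_mem_of_mem hv H
          omega
        · have := add_le_pairSize_of_mem_fst hv H (by omega)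
          omega
        · have := add_card_le_pairSize h₁ h₂ (Or.inl hv)
          have := countAbove_le (x := x) 1
          omega
    · rcases H with H | H | ⟨H, H'⟩
      · exact h.notMem_snd H
      · have := h.lt_of_mem H
        omega
      · have := h.4 1 H
        omega

end Bounds

lemma ncard_mem_snd {j : ℤ} {n : ℕ} (hn : 1 ≤ n) (hj : j < 2 * n) :
    {x ∈ overpart j | n ∈ x.2}.ncard = opZ (j - n) := by
  rw [← ncard_overpart]
  have hnot : ∀ x ∈ overpart (j - n), n ∉ x.2 := fun x hx h ↦ by
    have h₁ := add_card_le_pairSize hx.1 hx.2.1 (Or.inr h)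
    have h₂ := hx.2.2
    have h₃ : 0 < x.2.card := Finset.card_pos.2 ⟨n, h⟩
    omega
  symm
  refine Set.BijOn.ncard_eq (f := fun x ↦ (x.1, insert n x.2)) ⟨?_, ?_, ?_⟩
  · intro x hx
    have h := hnot x hx
    obtain ⟨h₁, h₂, h₃⟩ := hx
    refine ⟨⟨h₁, by simp [h₂]; omega, ?_⟩, by simp⟩
    simp only [pairSize, Finset.sum_insert h] at h₃ ⊢
    push_cast at h₃ ⊢
    linarith
  · rintro ⟨l, s⟩ hx ⟨l', s'⟩ hx' h
    have ns := hnot _ hx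
    have ns' := hnot _ hx'
    simp only [Prod.mk.injEq] at h ns ns' ⊢
    exact ⟨h.1, by rw [← Finset.erase_insert ns, h.2, Finset.erase_insert ns']⟩
  · rintro ⟨l, s⟩ ⟨⟨h₁, h₂, h₃⟩, hs⟩
    refine ⟨(l, s.erase n), ⟨h₁, fun h ↦ h₂ (Finset.mem_of_mem_erase h), ?_⟩, ?_⟩
    · have := Finset.sum_erase_add s (fun p ↦ p) hs
      simp only [pairSize] at h₃ this ⊢
      omega
    · simp [Finset.insert_erase hs]

lemma ncard_mem_fst {j : ℤ} {m : ℕ} (hm : 1 ≤ m) :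
    {x ∈ overpart j | m ∈ x.1}.ncard = opZ (j - m) := by
  rw [← ncard_overpart]
  symm
  refine Set.BijOn.ncard_eq (f := fun x ↦ (m ::ₘ x.1, x.2)) ⟨?_, ?_, ?_⟩
  · rintro x ⟨h₁, h₂, h₃⟩
    refine ⟨⟨by simp [h₁]; omega, h₂, ?_⟩, by simp⟩
    simp only [pairSize, Multiset.sum_cons] at h₃ ⊢
    push_cast at h₃ ⊢
    linarith
  · rintro ⟨l, s⟩ hx ⟨l', s'⟩ hx' h
    simpa using h
  · rintro ⟨l, s⟩ ⟨⟨h₁, h₂, h₃⟩, hl⟩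
    refine ⟨(l.erase m, s), ⟨fun h ↦ h₁ (Multiset.mem_of_mem_erase h), h₂, ?_⟩, ?_⟩
    · have := Multiset.sum_erase hl
      simp only [pairSize] at h₃ this ⊢
      omega
    · simp [Multiset.cons_erase hl]

/-- Increase all parts of a pair by 1 and then add parts 1 to `λ` up to `m` parts in total. -/
def raise (m : ℕ) (x : Multiset ℕ × Finset ℕ) : Multiset ℕ × Finset ℕ :=
  (x.1.map (· + 1) + Multiset.replicate (m - (x.1.card + x.2.card)) 1,
    x.2.map (addRightEmbedding 1))

lemma pairSize_raise {m : ℕ} {x : Multiset ℕ × Finset ℕ} (h : x.1.card + x.2.card ≤ m) :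
    pairSize (raise m x) = pairSize x + m := by
  simp only [pairSize, raise, Multiset.sum_add, Multiset.sum_map_add, Multiset.map_id',
    Multiset.map_const', Multiset.sum_replicate, smul_eq_mul, mul_one, Finset.sum_map,
    addRightEmbedding_apply, Finset.sum_add_distrib, Finset.sum_const]
  omega

lemma raise_injOn (m : ℕ) : Set.InjOn (raise m) {x | 0 ∉ x.1 ∧ 0 ∉ x.2} := by
  rintro ⟨l, s⟩ ⟨h, -⟩ ⟨l', s'⟩ ⟨h', -⟩ heq
  simp only [raise, Prod.mk.injEq] at heq h h' ⊢
  refine ⟨?_, Finset.map_injective _ heq.2⟩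
  have key : ∀ (t : Multiset ℕ) (r : ℕ), 0 ∉ t →
      (t.map (· + 1) + Multiset.replicate r 1).filter (1 < ·) = t.map (· + 1) := by
    intro t r ht
    rw [Multiset.filter_add, Multiset.filter_eq_self.2, Multiset.filter_eq_nil.2, add_zero]
    · intro a ha
      rw [Multiset.eq_of_mem_replicate ha]
      simp
    · intro a ha
      obtain ⟨b, hb, rfl⟩ := Multiset.mem_map.1 ha
      have : b ≠ 0 := by
        rintro rfl
        exact ht hb
      omega
  have := congrArg (Multiset.filter (1 < ·)) heq.1
  rw [key _ _ h, key _ _ h'] at this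
  exact Multiset.map_injective (add_left_injective 1) this

/-- The pairs of size `j` with `m` parts in total, counting only the parts of `μ` above 1, that
have a part 1 in `λ`. -/
def manyParts (j : ℤ) (m : ℕ) : Set (Multiset ℕ × Finset ℕ) :=
  {x ∈ overpart j | 1 ∈ x.1 ∧ countAbove x 1 = m}

lemma countAbove_one {x : Multiset ℕ × Finset ℕ} (h₁ : 0 ∉ x.1) :
    countAbove x 1 = x.1.card + (x.2.filter (1 < ·)).card := by
  rw [countAbove, Multiset.filter_eq_self.2]
  intro v hv
  refine Nat.pos_of_ne_zero ?_
  rintro rfl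
  exact h₁ hv

lemma ncard_manyParts_one_notMem {j : ℤ} {m : ℕ} (hj : j < 2 * m) :
    {x ∈ manyParts j m | 1 ∉ x.2}.ncard = opZ (j - m) := by
  rw [← ncard_overpart]
  symm
  have hlt : ∀ x ∈ overpart (j - m), x.1.card + x.2.card < m := fun x hx ↦ by
    have := card_add_card_le_pairSize hx.1 hx.2.1
    have := hx.2.2
    omega
  refine Set.BijOn.ncard_eq (f := raise m) ⟨?_, ?_, ?_⟩
  · intro x hx
    have hc := hlt x hx
    obtain ⟨h₁, h₂, h₃⟩ := hx
    have h₄ : 0 ∉ (raise m x).1 := by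
      simp [raise, Multiset.mem_replicate]
    refine ⟨⟨⟨h₄, ?_, ?_⟩, ?_, ?_⟩, ?_⟩
    · simp [raise]
    · rw [pairSize_raise hc.le]
      push_cast
      omega
    · simp only [raise, Multiset.mem_add, Multiset.mem_replicate]
      exact Or.inr ⟨by omega, trivial⟩
    · rw [countAbove_one h₄, Finset.filter_true_of_mem]
      · simp only [raise, Multiset.card_add, Multiset.card_map, Multiset.card_replicate,
          Finset.card_map]
        omega
      · intro p hp
        obtain ⟨q, hq, rfl⟩ := Finset.mem_map.1 hp
        have : q ≠ 0 := by
          rintro rfl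
          exact h₂ hq
        simp only [addRightEmbedding_apply]
        omega
    · simp [raise, h₂]
  · exact fun x hx y hy ↦ raise_injOn m ⟨hx.1, hx.2.1⟩ ⟨hy.1, hy.2.1⟩
  · rintro ⟨l, s⟩ ⟨⟨⟨h₁, h₂, h₃⟩, h₄, h₅⟩, h₆⟩
    rw [countAbove_one h₁] at h₅
    simp only at h₁ h₂ h₄ h₅ h₆
    have hs : ∀ p ∈ s, 1 < p := fun p hp ↦ by
      have : p ≠ 0 := fun h ↦ h₂ (h ▸ hp)
      have : p ≠ 1 := fun h ↦ h₆ (h ▸ hp)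
      omega
    rw [Finset.filter_true_of_mem hs] at h₅
    have hinj : Set.InjOn (fun p ↦ p - 1) (s : Set ℕ) := fun p hp q hq h ↦ by
      have := hs p hp
      have := hs q hq
      simp only at h
      omega
    have hcard := congrArg Multiset.card (Multiset.filter_add_not (1 < ·) l)
    rw [Multiset.card_add] at hcard
    have hraise : raise m ((l.filter (1 < ·)).map (· - 1), s.image (· - 1)) = (l, s) := by
      simp only [raise, Multiset.map_map, Multiset.card_map, Finset.card_image_of_injOn hinj,
        Prod.mk.injEq]
      constructor
      · conv_rhs => rw [← Multiset.filter_add_not (1 < ·) l]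
        congr 1
        · conv_rhs => rw [← Multiset.map_id (l.filter (1 < ·))]
          refine Multiset.map_congr rfl fun v hv ↦ ?_
          have := (Multiset.mem_filter.1 hv).2
          simp only [Function.comp_apply, id]
          omega
        · symm
          rw [Multiset.eq_replicate]
          refine ⟨by omega, fun v hv ↦ ?_⟩
          obtain ⟨hv, hv'⟩ := Multiset.mem_filter.1 hv
          have : v ≠ 0 := fun h ↦ h₁ (h ▸ hv)
          omega
      · ext p
        simp only [Finset.mem_map, Finset.mem_image, addRightEmbedding_apply]
        constructor
        · rintro ⟨_, ⟨q, hq, rfl⟩, rfl⟩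
          have := hs q hq
          rwa [Nat.sub_add_cancel (by omega)]
        · intro hp
          have := hs p hp
          exact ⟨p - 1, ⟨p, hp, rfl⟩, by omega⟩
    refine ⟨_, ⟨?_, ?_, ?_⟩, hraise⟩
    · simp only [Multiset.mem_map, Multiset.mem_filter, not_exists, not_and]
      omega
    · simp only [Finset.mem_image, not_exists, not_and]
      intro p hp
      have := hs p hp
      omega
    · have h₇ := pairSize_raise (m := m)
        (x := ((l.filter (1 < ·)).map (· - 1), s.image (· - 1))) (by
          simp only [Multiset.card_map, Finset.card_image_of_injOn hinj]
          omega)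
      rw [hraise] at h₇
      omega

lemma ncard_manyParts_one_mem (j : ℤ) (m : ℕ) :
    {x ∈ manyParts j m | 1 ∈ x.2}.ncard = {x ∈ manyParts (j - 1) m | 1 ∉ x.2}.ncard := by
  symm
  have hfilter : ∀ s : Finset ℕ, (insert 1 s).filter (1 < ·) = s.filter (1 < ·) := fun s ↦ by
    rw [Finset.filter_insert, if_neg (lt_irrefl 1)]
  refine Set.BijOn.ncard_eq (f := fun x ↦ (x.1, insert 1 x.2)) ⟨?_, ?_, ?_⟩
  · rintro ⟨l, s⟩ ⟨⟨⟨h₁, h₂, h₃⟩, h₄, h₅⟩, h₆⟩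
    refine ⟨⟨⟨h₁, by simpa using h₂, ?_⟩, h₄, ?_⟩, by simp⟩
    · simp only [pairSize] at h₃ h₆ ⊢
      rw [Finset.sum_insert h₆]
      omega
    · simpa only [countAbove, hfilter] using h₅
  · rintro ⟨l, s⟩ ⟨-, ns⟩ ⟨l', s'⟩ ⟨-, ns'⟩ h
    simp only [Prod.mk.injEq] at h ns ns' ⊢
    exact ⟨h.1, by rw [← Finset.erase_insert ns, h.2, Finset.erase_insert ns']⟩
  · rintro ⟨l, s⟩ ⟨⟨⟨h₁, h₂, h₃⟩, h₄, h₅⟩, h₆⟩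
    simp only at h₆
    refine ⟨(l, s.erase 1), ⟨⟨⟨h₁, fun h ↦ h₂ (Finset.mem_of_mem_erase h), ?_⟩, h₄, ?_⟩, by simp⟩,
      by simp [Finset.insert_erase h₆]⟩
    · have := Finset.sum_erase_add s (fun p ↦ p) h₆
      simp only [pairSize] at h₃ this ⊢
      omega
    · rw [← h₅]
      simp only [countAbove]
      rw [← hfilter (s.erase 1), Finset.insert_erase h₆]

lemma ncard_manyParts {j : ℤ} {m : ℕ} (hj : j < 2 * m) :
    (manyParts j m).ncard = opZ (j - m) + opZ (j - m - 1) := by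
  have hfin : (manyParts j m).Finite := (overpart_finite j).subset fun x hx ↦ hx.1
  have hunion : manyParts j m = {x ∈ manyParts j m | 1 ∉ x.2} ∪ {x ∈ manyParts j m | 1 ∈ x.2} := by
    ext x
    simp only [Set.mem_union, Set.mem_ofPred_eq]
    tauto
  rw [hunion, Set.ncard_union_eq _ (hfin.subset fun x hx ↦ hx.1)
      (hfin.subset fun x hx ↦ hx.1), ncard_manyParts_one_notMem hj, ncard_manyParts_one_mem,
    ncard_manyParts_one_notMem (by omega), sub_right_comm]
  exact Set.disjoint_left.2 fun x hx hx' ↦ hx.2 hx'.2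

/-- For every `k ≥ 0` and every `n` with `2n ≥ k + 7`, the difference
`av_{n+1}^k(1324, 1342) − av_n^k(1324, 1342)` is nonnegative and equals
`2·op(k−n+1) + 2·op(k−n)`, where `op(j) = 0` for `j < 0`. -/
theorem av_1324_1342_diff (k n : ℕ) (h : k + 7 ≤ 2 * n) :
    av (n + 1) k = av n k + 2 * opZ ((k : ℤ) - n + 1) + 2 * opZ ((k : ℤ) - n) := by
  rw [av_eq_ncard (n + 1) k (by omega), av_eq_ncard n k (by omega)]
  have hunion : {x | Fits (n + 1) x ∧ pairSize x = k} = {x | Fits n x ∧ pairSize x = k} ∪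
      ({x ∈ overpart k | n ∈ x.2} ∪ ({x ∈ overpart k | n - 1 ∈ x.1} ∪ manyParts k (n - 1))) := by
    ext x
    simp only [Set.mem_union, Set.mem_ofPred_eq, manyParts, overpart, Nat.cast_inj]
    constructor
    · rintro ⟨hx, rfl⟩
      have := fits_succ_and_not_fits_iff hx.1 hx.2 h
      have := hx.1
      have := hx.2
      tauto
    · rintro (⟨hx, rfl⟩ | hx)
      · refine ⟨⟨hx.1, hx.2, fun p hp ↦ (hx.3 p hp).trans (by omega),
          fun v hv ↦ (hx.4 v hv).trans (by omega)⟩, rfl⟩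
      · obtain ⟨h₁, h₂, rfl⟩ : 0 ∉ x.1 ∧ 0 ∉ x.2 ∧ pairSize x = k := by tauto
        have := fits_succ_and_not_fits_iff h₁ h₂ h
        tauto
  have hfin : ∀ {s : Set (Multiset ℕ × Finset ℕ)}, s ⊆ overpart k → s.Finite :=
    fun hs ↦ (overpart_finite k).subset hs
  have hA : {x ∈ overpart k | n ∈ x.2} ⊆ overpart k := fun x hx ↦ hx.1
  have hB : {x ∈ overpart k | n - 1 ∈ x.1} ⊆ overpart k := fun x hx ↦ hx.1
  have hC : manyParts k (n - 1) ⊆ overpart k := fun x hx ↦ hx.1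
  have hsize : ∀ {x}, x ∈ overpart k → pairSize x = k := fun hx ↦ by exact_mod_cast hx.2.2
  rw [hunion, Set.ncard_union_eq _ (hfin fun x hx ↦ ⟨hx.1.1, hx.1.2, by rw [hx.2]⟩)
      (hfin (Set.union_subset hA (Set.union_subset hB hC))),
    Set.ncard_union_eq _ (hfin hA) (hfin (Set.union_subset hB hC)),
    Set.ncard_union_eq _ (hfin hB) (hfin hC), ncard_mem_snd (by omega) (by omega),
    ncard_mem_fst (by omega), ncard_manyParts (by omega)]
  · rw [show (k : ℤ) - ((n - 1 : ℕ) : ℤ) = k - n + 1 by omega, add_sub_cancel_right]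
    ring
  · refine Set.disjoint_left.2 fun x hx hx' ↦ ?_
    have h₁ := add_card_le_pairSize hx.1.1 hx.1.2.1 (Or.inl hx.2)
    have h₂ := countAbove_le (x := x) 1
    have h₃ := hx'.2.2
    have h₄ := hsize hx.1
    omega
  · refine Set.disjoint_left.2 fun x hx hx' ↦ ?_
    have h₄ := hsize hx.1
    rcases hx' with hx' | hx'
    · have h₁ := add_le_pairSize_of_mem_of_mem hx'.2 hx.2
      omega
    · have h₁ := add_card_le_pairSize hx.1.1 hx.1.2.1 (Or.inr hx.2)
      have h₂ := countAbove_le (x := x) 1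
      have h₃ := hx'.2.2
      omega
  · refine Set.disjoint_left.2 fun x hx hx' ↦ ?_
    have hx₀ : x ∈ overpart k := Set.union_subset hA (Set.union_subset hB hC) hx'
    have h₄ := hsize hx₀
    refine ((fits_succ_and_not_fits_iff hx₀.1 hx₀.2.1 (n := n) (by omega)).2 ?_).2 hx.1
    rcases hx' with hx' | hx' | hx'
    · exact Or.inl hx'.2
    · exact Or.inr (Or.inl hx'.2)
    · exact Or.inr (Or.inr hx'.2)
end

section
/- Let π be an indecomposable 132-avoiding permutation and let λ = Λ(π) be the partition given by its Lehmer code. Then π avoids the pattern 3241 if and only if λ is steep, meaning that for any two consecutive distinct part sizes of λ, the difference between the larger and the smaller is at least the multiplicity of the smaller part in λ. -/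
/-- The pattern 132. -/
def p132 : Equiv.Perm (Fin 3) := ⟨![0,2,1], ![0,2,1], by decide, by decide⟩

/-- `π` is indecomposable: it is not the direct sum of two nonempty permutations,
i.e. there is no `0 < d < n` such that the first `d` positions carry the values `0, …, d-1`. -/
def Indecomposable {n : ℕ} (π : Equiv.Perm (Fin n)) : Prop :=
  ¬ ∃ d : ℕ, 0 < d ∧ d < n ∧ ∀ i : Fin n, (i : ℕ) < d → (π i : ℕ) < d

/-- The Lehmer code of `π` at position `i`: the number of positions `j > i` with
`π j < π i`.  For an indecomposable `132`-avoiding permutation the Lehmer code is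
weakly decreasing and its nonzero entries form the partition `Λ(π)` of `inv(π)`. -/
noncomputable def lehmer {n : ℕ} (π : Equiv.Perm (Fin n)) (i : Fin n) : ℕ :=
  Nat.card {j : Fin n // i < j ∧ π j < π i}

/-- The Lehmer code of `π`, extended by zeroes beyond position `n`; for an indecomposable
`132`-avoider this is exactly the partition `λ = Λ(π)` with the convention `λ_i = 0` for
indices `i` beyond the number of parts (indices are 0-based here). -/
noncomputable def lehmerExt {n : ℕ} (π : Equiv.Perm (Fin n)) (i : ℕ) : ℕ :=
  if h : i < n then lehmer π ⟨i, h⟩ else 0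

def p3241 : Equiv.Perm (Fin 4) := ⟨![2,1,3,0], ![3,1,0,2], by decide, by decide⟩

/-- The positions counted by the Lehmer code of `π` at position `i`. -/
def lehmerSet {n : ℕ} (π : Equiv.Perm (Fin n)) (i : Fin n) : Finset (Fin n) :=
  {j | i < j ∧ π j < π i}

lemma mem_lehmerSet {n : ℕ} {π : Equiv.Perm (Fin n)} {i j : Fin n} :
    j ∈ lehmerSet π i ↔ i < j ∧ π j < π i := by
  simp [lehmerSet]

lemma lehmer_eq_card {n : ℕ} (π : Equiv.Perm (Fin n)) (i : Fin n) :
    lehmer π i = (lehmerSet π i).card := by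
  rw [lehmer, Nat.card_eq_fintype_card, Fintype.card_subtype, lehmerSet]

lemma exists_of_lehmer_pos {n : ℕ} {π : Equiv.Perm (Fin n)} {i : Fin n} (h : 0 < lehmer π i) :
    ∃ j, i < j ∧ π j < π i := by
  rw [lehmer_eq_card, Finset.card_pos] at h
  obtain ⟨j, hj⟩ := h
  exact ⟨j, mem_lehmerSet.1 hj⟩

lemma Avoids.lt_of_lt_of_lt {n : ℕ} {π : Equiv.Perm (Fin n)} (h : Avoids π p132)
    {i j k : Fin n} (hij : i < j) (hjk : j < k) (h₁ : π i < π j) (h₂ : π k < π j) :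
    π k < π i := by
  by_contra hki
  have hik : π i < π k := lt_of_le_of_ne (not_lt.1 hki) (π.injective.ne (hij.trans hjk).ne)
  refine h ⟨![i, j, k], ?_, ?_⟩
  · refine Fin.strictMono_iff_lt_succ.2 fun a => ?_
    fin_cases a <;> simp [hij, hjk]
  · intro a b
    fin_cases a <;> fin_cases b <;>
      simp [p132, h₁, h₂, hik, h₁.le, h₂.le, hik.le]

lemma contains_p3241_iff {n : ℕ} {π : Equiv.Perm (Fin n)} :
    Contains π p3241 ↔
      ∃ i j k l, i < j ∧ j < k ∧ k < l ∧ π l < π j ∧ π j < π i ∧ π i < π k := by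
  constructor
  · rintro ⟨f, hf, hp⟩
    exact ⟨f 0, f 1, f 2, f 3, hf (by decide), hf (by decide), hf (by decide),
      (hp _ _).2 (by decide), (hp _ _).2 (by decide), (hp _ _).2 (by decide)⟩
  · rintro ⟨i, j, k, l, hij, hjk, hkl, h₁, h₂, h₃⟩
    have h₄ := h₁.trans h₂
    have h₅ := h₂.trans h₃
    have h₆ := h₄.trans h₃
    refine ⟨![i, j, k, l], ?_, ?_⟩
    · refine Fin.strictMono_iff_lt_succ.2 fun a => ?_
      fin_cases a <;> simp [hij, hjk, hkl]
    · intro a b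
      fin_cases a <;> fin_cases b <;>
        simp [p3241, h₁, h₂, h₃, h₄, h₅, h₆, h₁.le, h₂.le, h₃.le, h₄.le, h₅.le, h₆.le]

lemma lehmer_lt_of_lt {n : ℕ} {π : Equiv.Perm (Fin n)} {i j : Fin n} (hij : i < j)
    (h : π j < π i) : lehmer π j < lehmer π i := by
  rw [lehmer_eq_card, lehmer_eq_card]
  refine Finset.card_lt_card ((Finset.ssubset_iff_of_subset fun k hk => ?_).2 ⟨j, ?_, ?_⟩)
  · rw [mem_lehmerSet] at hk ⊢
    exact ⟨hij.trans hk.1, hk.2.trans h⟩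
  · exact mem_lehmerSet.2 ⟨hij, h⟩
  · simp [mem_lehmerSet]

/-- The Lehmer code of a 132-avoiding permutation is weakly decreasing. -/
lemma lehmer_antitone {n : ℕ} {π : Equiv.Perm (Fin n)} (h132 : Avoids π p132) :
    Antitone (lehmer π) := by
  intro i j hij
  rcases hij.eq_or_lt with rfl | hij
  · rfl
  rcases lt_or_gt_of_ne (π.injective.ne hij.ne) with h | h
  · rw [lehmer_eq_card, lehmer_eq_card]
    refine Finset.card_le_card fun k hk => ?_
    rw [mem_lehmerSet] at hk ⊢
    exact ⟨hij.trans hk.1, h132.lt_of_lt_of_lt hij hk.1 h hk.2⟩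
  · exact (lehmer_lt_of_lt hij h).le

/-- If `π` avoids 132 and 3241, a larger entry of the Lehmer code belongs to a larger value of `π`
than any smaller positive entry. -/
lemma apply_lt_of_lehmer_lt {n : ℕ} {π : Equiv.Perm (Fin n)} (h132 : Avoids π p132)
    (h : Avoids π p3241) {p k : Fin n} (hk : 0 < lehmer π k) (hpk : lehmer π k < lehmer π p) :
    π k < π p := by
  have hlt : p < k := (lehmer_antitone h132).reflect_lt hpk
  by_contra hle
  have hπ : π p < π k := lt_of_le_of_ne (not_lt.1 hle) (π.injective.ne hlt.ne)
  obtain ⟨j, hj, hj'⟩ : ∃ j ∈ lehmerSet π p, j ∉ lehmerSet π k := by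
    refine Finset.exists_mem_notMem_of_card_lt_card ?_
    rwa [← lehmer_eq_card, ← lehmer_eq_card]
  rw [mem_lehmerSet] at hj hj'
  have hjπ : π j < π k := hj.2.trans hπ
  have hjk : j < k := by
    refine lt_of_le_of_ne (not_lt.1 fun hkj => hj' ⟨hkj, hjπ⟩) ?_
    rintro rfl
    exact hjπ.false
  obtain ⟨l, hkl, hl⟩ := exists_of_lehmer_pos hk
  exact h (contains_p3241_iff.2
    ⟨p, j, k, l, hj.1, hjk, hkl, h132.lt_of_lt_of_lt hjk hkl hjπ hl, hj.2, hπ⟩)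

/-- Let `π` be an indecomposable 132-avoiding permutation and `λ = Λ(π)` the partition
given by its Lehmer code (the parts of `λ` are the positive values of `lehmer π`).
Then `π` avoids 3241 if and only if `λ` is steep: for any two consecutive distinct part
sizes `a > b > 0` of `λ` (both occur as parts and no part lies strictly between them),
the difference `a − b` is at least the multiplicity of `b` in `λ`. -/
theorem avoids_3241_iff_steep (n : ℕ) (π : Equiv.Perm (Fin n))
    (hind : Indecomposable π) (h132 : Avoids π p132) :
    Avoids π p3241 ↔
      ∀ a b : ℕ, 0 < b → b < a →
        (∃ i : Fin n, lehmer π i = a) → (∃ i : Fin n, lehmer π i = b) →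
        (∀ c : ℕ, b < c → c < a → ¬ ∃ i : Fin n, lehmer π i = c) →
        Nat.card {i : Fin n // lehmer π i = b} + b ≤ a := by
  have hcard (b : ℕ) : Nat.card {i : Fin n // lehmer π i = b} =
      ({i | lehmer π i = b} : Finset (Fin n)).card := by
    rw [Nat.card_eq_fintype_card, Fintype.card_subtype]
  have hanti := lehmer_antitone h132
  constructor
  · rintro h a b hb hba ⟨p, rfl⟩ hex -
    rw [hcard]
    set B : Finset (Fin n) := {i | lehmer π i = b} with hB
    have hBne : B.Nonempty := by
      obtain ⟨i, hi⟩ := hex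
      exact ⟨i, by simp [hB, hi]⟩
    obtain ⟨e, he, hmax⟩ := B.exists_maximal hBne
    have hle : ∀ i ∈ B, i ≤ e := fun i hi => (le_total i e).elim id (hmax hi)
    have hval : ∀ i ∈ B, lehmer π i = b := fun i hi => by simpa [hB] using hi
    have hlt : ∀ i ∈ B, p < i ∧ π i < π p := fun i hi =>
      ⟨hanti.reflect_lt (by rwa [hval i hi]),
        apply_lt_of_lehmer_lt h132 h (by rwa [hval i hi]) (by rwa [hval i hi])⟩
    have hdisj : Disjoint B (lehmerSet π e) := Finset.disjoint_left.2 fun i hi hi' =>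
      (hle i hi).not_gt (mem_lehmerSet.1 hi').1
    conv_lhs => rw [← hval e he]
    rw [lehmer_eq_card, lehmer_eq_card, ← Finset.card_union_of_disjoint hdisj]
    refine Finset.card_le_card fun i hi => ?_
    rw [mem_lehmerSet]
    rcases Finset.mem_union.1 hi with hi | hi
    · exact hlt i hi
    · rw [mem_lehmerSet] at hi
      exact ⟨(hlt e he).1.trans hi.1, hi.2.trans (hlt e he).2⟩
  · intro hsteep hcon
    obtain ⟨i, j, k, l, hij, hjk, hkl, hlj, hji, hik⟩ := contains_p3241_iff.1 hcon
    have hk : 0 < lehmer π k :=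
      (Nat.zero_le _).trans_lt (lehmer_lt_of_lt hkl (hlj.trans (hji.trans hik)))
    have hki : lehmer π k < lehmer π i :=
      (hanti hjk.le).trans_lt (lehmer_lt_of_lt hij hji)
    -- the last position whose Lehmer entry exceeds that of `k`
    obtain ⟨p, hp, hmax⟩ := ({q | lehmer π k < lehmer π q} : Finset (Fin n)).exists_maximal
      ⟨i, by simpa using hki⟩
    have hkp : lehmer π k < lehmer π p := by simpa using hp
    have hle : ∀ q, lehmer π k < lehmer π q → q ≤ p := fun q hq =>
      (le_total q p).elim id (hmax (by simpa using hq))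
    have hpk : p < k := hanti.reflect_lt hkp
    have hπ : π p < π k := by
      by_contra hn
      have hkp' : π k < π p := lt_of_le_of_ne (not_lt.1 hn) (π.injective.ne hpk.ne')
      have hip : i < p := lt_of_le_of_ne (hle i hki) (by rintro rfl; exact hn hik)
      exact (h132.lt_of_lt_of_lt hip hpk (hik.trans hkp') hkp').not_gt hik
    have hbound := hsteep (lehmer π p) (lehmer π k) hk hkp ⟨p, rfl⟩ ⟨k, rfl⟩ (by
      rintro c hc hcp ⟨q, rfl⟩
      exact (hle q hc).not_gt (hanti.reflect_lt hcp))
    rw [hcard] at hbound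
    have hsub : lehmerSet π p ⊆
        ({q | lehmer π q = lehmer π k} : Finset (Fin n)).erase k ∪ lehmerSet π k := by
      intro q hq
      rw [mem_lehmerSet] at hq
      rw [Finset.mem_union, Finset.mem_erase, mem_lehmerSet]
      rcases lt_or_ge k q with hkq | hqk
      · exact Or.inr ⟨hkq, hq.2.trans hπ⟩
      · refine Or.inl ⟨?_, ?_⟩
        · rintro rfl
          exact hq.2.not_gt hπ
        · have : lehmer π q ≤ lehmer π k := not_lt.1 fun h => (hle q h).not_gt hq.1
          simpa using this.antisymm (hanti hqk)
    have hcount := (Finset.card_le_card hsub).trans (Finset.card_union_le _ _)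
    rw [← lehmer_eq_card, ← lehmer_eq_card] at hcount
    have herase := Finset.card_erase_lt_of_mem
      (show k ∈ ({q | lehmer π q = lehmer π k} : Finset (Fin n)) by simp)
    omega
end
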